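/- Let u = −(−,+,−,−) − (+,+,−,−) − (+,−,−,+) + (−,−,−,−) in V. Then for every real number λ ≠ 0, the hypermatrix λ•u lies in the G-orbit of u. -/

import Mathlib

/-- The space of real 2×2×2×2 hypermatrices. -/
abbrev V : Type := Fin 2 → Fin 2 → Fin 2 → Fin 2 → ℝ

/-- The group `SL₂(ℝ)⁴`. -/
abbrev G : Type :=
  Matrix.SpecialLinearGroup (Fin 2) ℝ × Matrix.SpecialLinearGroup (Fin 2) ℝ ×
    Matrix.SpecialLinearGroup (Fin 2) ℝ × Matrix.SpecialLinearGroup (Fin 2) ℝ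

/-- The natural linear action of `G = SL₂(ℝ)⁴` on `V`. -/
noncomputable def actG (g : G) (T : V) : V := fun i₁ i₂ i₃ i₄ =>
  ∑ j₁ : Fin 2, ∑ j₂ : Fin 2, ∑ j₃ : Fin 2, ∑ j₄ : Fin 2,
    (g.1 : Matrix (Fin 2) (Fin 2) ℝ) i₁ j₁ * (g.2.1 : Matrix (Fin 2) (Fin 2) ℝ) i₂ j₂ *
      (g.2.2.1 : Matrix (Fin 2) (Fin 2) ℝ) i₃ j₃ * (g.2.2.2 : Matrix (Fin 2) (Fin 2) ℝ) i₄ j₄ *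
      T j₁ j₂ j₃ j₄

/-- The basis hypermatrix with a single `1` at position `(a,b,c,d)`; the sign `+` corresponds to
index `0` and the sign `−` to index `1`. -/
def bv (a b c d : Fin 2) : V := fun i₁ i₂ i₃ i₄ =>
  if i₁ = a ∧ i₂ = b ∧ i₃ = c ∧ i₄ = d then 1 else 0

/-- `u = −(−,+,−,−) − (+,+,−,−) − (+,−,−,+) + (−,−,−,−)` -/
noncomputable def u₈ : V := -bv 1 0 1 1 - bv 0 0 1 1 - bv 0 1 1 0 + bv 1 1 1 1

/-- For every nonzero real `λ`, the hypermatrix `λ•u` lies in the `G`-orbit of `u`. -/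
theorem scalar_multiples_in_orbit :
    ∀ lam : ℝ, lam ≠ 0 → ∃ g : G, actG g u₈ = lam • u₈ := by
  intro lam hlam
  refine ⟨(1, 1, ⟨!![lam⁻¹, 0; 0, lam], by simp [Matrix.det_fin_two, hlam]⟩, 1), ?_⟩
  ext i₁ i₂ i₃ i₄
  fin_cases i₁ <;> fin_cases i₂ <;> fin_cases i₃ <;> fin_cases i₄ <;>
    simp [actG, u₈, bv, Matrix.one_apply]
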